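/- arXiv:2210.11270 — 8 statements merged into one kernel-verified Lean document; each statement's English description precedes it below -/
import Mathlib

section
/- A finite dynamical system f : α → α on a finite set α is cancellative (i.e., for all FDSs g : β → β and h : γ → γ on finite sets, if f × g is isomorphic to f × h then g is isomorphic to h) if and only if f has a fixpoint, i.e., there exists a ∈ α with f a = a. -/
/-- Two dynamical systems are isomorphic if there is a bijection commuting with the maps. -/
def FDSIso {α β : Type} (f : α → α) (g : β → β) : Prop :=
  ∃ e : α ≃ β, ∀ x, e (f x) = g (e x)

open Function

namespace FDS

/-- Homomorphisms between dynamical systems. -/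
abbrev Hom {κ β : Type} (k : κ → κ) (g : β → β) : Type :=
  {φ : κ → β // Semiconj φ k g}

/-- Injective homomorphisms between dynamical systems. -/
abbrev Emb {κ β : Type} (k : κ → κ) (g : β → β) : Type :=
  {φ : κ → β // Semiconj φ k g ∧ Injective φ}

/-- A homomorphism into a product is a pair of homomorphisms. -/
def homProdEquiv {κ α β : Type} (k : κ → κ) (f : α → α) (g : β → β) :
    Hom k (Prod.map f g) ≃ Hom k f × Hom k g where
  toFun φ := (⟨fun x => (φ.1 x).1, fun x => congrArg Prod.fst (φ.2 x)⟩,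
    ⟨fun x => (φ.1 x).2, fun x => congrArg Prod.snd (φ.2 x)⟩)
  invFun p := ⟨fun x => (p.1.1 x, p.2.1 x), fun x => Prod.ext (p.1.2 x) (p.2.2 x)⟩
  left_inv _ := rfl
  right_inv _ := rfl

/-- An isomorphism of targets induces a bijection on homomorphisms. -/
def homCongr {κ β γ : Type} (k : κ → κ) {g : β → β} {h : γ → γ} (e : β ≃ γ)
    (he : ∀ x, e (g x) = h (e x)) : Hom k g ≃ Hom k h where
  toFun φ := ⟨fun x => e (φ.1 x), fun x => (congrArg e (φ.2 x)).trans (he _)⟩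
  invFun φ := ⟨fun x => e.symm (φ.1 x), fun x => by
    change e.symm (φ.1 (k x)) = g (e.symm (φ.1 x))
    rw [e.symm_apply_eq, he, e.apply_symm_apply, φ.2 x]⟩
  left_inv φ := by ext; simp
  right_inv φ := by ext; simp

/-- Homomorphisms with a given kernel are embeddings of the quotient system. -/
def kerEquivEmb {κ β : Type} {k : κ → κ} (g : β → β) (s : Setoid κ)
    (hs : ∀ x y, s x y → s (k x) (k y)) :
    {φ : Hom k g // Setoid.ker φ.1 = s} ≃ Emb (Quotient.map k hs : Quotient s → Quotient s) g where
  toFun φ := ⟨Quotient.lift φ.1.1 fun x y hxy => by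
      have : Setoid.ker φ.1.1 x y := by rw [φ.2]; exact hxy
      exact this, by
    constructor
    · rintro ⟨x⟩
      exact φ.1.2 x
    · rintro ⟨x⟩ ⟨y⟩ hxy
      refine Quotient.sound ?_
      change s x y
      rw [← φ.2]
      exact hxy⟩
  invFun ψ := ⟨⟨fun x => ψ.1 ⟦x⟧, fun x => ψ.2.1 ⟦x⟧⟩, by
    ext x y
    exact ψ.2.2.eq_iff.trans Quotient.eq⟩
  left_inv _ := rfl
  right_inv ψ := by
    ext ⟨x⟩
    rfl

/-- Homomorphisms with trivial kernel are embeddings. -/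
def kerBotEquivEmb {κ β : Type} (k : κ → κ) (g : β → β) :
    {φ : Hom k g // Setoid.ker φ.1 = ⊥} ≃ Emb k g where
  toFun φ := ⟨φ.1.1, φ.1.2, (Setoid.injective_iff_ker_bot _).2 φ.2⟩
  invFun ψ := ⟨⟨ψ.1, ψ.2.1⟩, (Setoid.injective_iff_ker_bot _).1 ψ.2.2⟩
  left_inv _ := rfl
  right_inv _ := rfl

theorem card_hom_eq_sum {κ β : Type} [Finite κ] [Finite β] [Fintype (Setoid κ)]
    (k : κ → κ) (g : β → β) :
    Nat.card (Hom k g) = ∑ s : Setoid κ, Nat.card {φ : Hom k g // Setoid.ker φ.1 = s} := by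
  rw [← Nat.card_sigma]
  exact Nat.card_congr (Equiv.sigmaFiberEquiv fun φ : Hom k g => Setoid.ker φ.1).symm

theorem card_quotient_lt {κ : Type} [Finite κ] {s : Setoid κ} (hs : s ≠ ⊥) :
    Nat.card (Quotient s) < Nat.card κ := by
  refine lt_of_le_of_ne (Nat.card_le_card_of_surjective _ (Quotient.mk_surjective (s := s))) ?_
  intro h
  have hb := (Nat.bijective_iff_surjective_and_card (Quotient.mk s)).2
    ⟨Quotient.mk_surjective, h.symm⟩
  apply hs
  ext x y
  exact ⟨fun hxy => hb.1 (Quotient.sound hxy), fun hxy => by cases hxy; exact s.refl x⟩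

/-- Equal numbers of homomorphisms from all finite systems give equal numbers of embeddings. -/
theorem card_emb_eq {β γ : Type} [Finite β] [Finite γ] {g : β → β} {h : γ → γ}
    (H : ∀ (κ : Type) [Finite κ] (k : κ → κ), Nat.card (Hom k g) = Nat.card (Hom k h))
    (κ : Type) [Finite κ] (k : κ → κ) : Nat.card (Emb k g) = Nat.card (Emb k h) := by
  classical
  induction hn : Nat.card κ using Nat.strong_induction_on generalizing κ with
  | _ n ih =>
    subst hn
    have : Finite (Setoid κ) :=
      Finite.of_injective (fun s : Setoid κ => (fun x y => s x y : κ → κ → Prop))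
        fun s t hst => Setoid.ext fun x y => iff_of_eq (congrFun₂ hst x y)
    have := Fintype.ofFinite (Setoid κ)
    have key : ∀ s : Setoid κ, s ≠ ⊥ →
        Nat.card {φ : Hom k g // Setoid.ker φ.1 = s} =
          Nat.card {φ : Hom k h // Setoid.ker φ.1 = s} := by
      intro s hs
      by_cases hk : ∀ x y, s x y → s (k x) (k y)
      · rw [Nat.card_congr (kerEquivEmb g s hk), Nat.card_congr (kerEquivEmb h s hk)]
        exact ih _ (card_quotient_lt hs) _ _ rfl
      · have empty {δ : Type} (d : δ → δ) : IsEmpty {φ : Hom k d // Setoid.ker φ.1 = s} := by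
          refine ⟨fun φ => hk ?_⟩
          rw [← φ.2]
          intro x y hxy
          change φ.1.1 x = φ.1.1 y at hxy
          change φ.1.1 (k x) = φ.1.1 (k y)
          rw [φ.1.2 x, φ.1.2 y, hxy]
        have := empty g
        have := empty h
        simp
    have hsum := H κ k
    rw [card_hom_eq_sum, card_hom_eq_sum, ← Finset.add_sum_erase _ _ (Finset.mem_univ ⊥),
      ← Finset.add_sum_erase _ _ (Finset.mem_univ ⊥),
      Finset.sum_congr rfl fun s hs => key s (Finset.ne_of_mem_erase hs)] at hsum
    rw [← Nat.card_congr (kerBotEquivEmb k g), ← Nat.card_congr (kerBotEquivEmb k h)]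
    exact Nat.add_right_cancel hsum

/-- A finite system is determined up to isomorphism by its homomorphism counts. -/
theorem iso_of_card_hom_eq {β γ : Type} [Finite β] [Finite γ] {g : β → β} {h : γ → γ}
    (H : ∀ (κ : Type) [Finite κ] (k : κ → κ), Nat.card (Hom k g) = Nat.card (Hom k h)) :
    FDSIso g h := by
  have hg : Nonempty (Emb g h) := by
    have : Nonempty (Emb g g) := ⟨⟨id, Semiconj.id_left, injective_id⟩⟩
    exact (Nat.card_pos_iff.1 (card_emb_eq H β g ▸ Nat.card_pos)).1
  have hh : Nonempty (Emb h g) := by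
    have : Nonempty (Emb h h) := ⟨⟨id, Semiconj.id_left, injective_id⟩⟩
    exact (Nat.card_pos_iff.1 ((card_emb_eq H γ h).symm ▸ Nat.card_pos)).1
  obtain ⟨φ, hφ, hφi⟩ := hg
  obtain ⟨ψ, -, hψi⟩ := hh
  have hb := (Nat.bijective_iff_injective_and_card φ).2 ⟨hφi,
    (Nat.card_le_card_of_injective φ hφi).antisymm (Nat.card_le_card_of_injective ψ hψi)⟩
  exact ⟨Equiv.ofBijective φ hb, hφ⟩

theorem iso_of_prod_iso {α β γ : Type} [Finite α] [Finite β] [Finite γ] {f : α → α}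
    {g : β → β} {h : γ → γ} {a : α} (ha : f a = a)
    (H : FDSIso (Prod.map f g) (Prod.map f h)) : FDSIso g h := by
  obtain ⟨e, he⟩ := H
  refine iso_of_card_hom_eq fun κ _ k => ?_
  have : Nonempty (Hom k f) := ⟨⟨fun _ => a, fun _ => ha.symm⟩⟩
  have := Nat.card_congr (homCongr k e he)
  rw [Nat.card_congr (homProdEquiv k f g), Nat.card_congr (homProdEquiv k f h),
    Nat.card_prod, Nat.card_prod] at this
  exact Nat.eq_of_mul_eq_mul_left Nat.card_pos this

theorem exists_periodic_iterate {α : Type} [Finite α] (f : α → α) (x : α) :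
    ∃ y ∈ periodicPts f, ∃ n, f^[n] x = y := by
  obtain ⟨m, n, hmn, h⟩ := Finite.exists_ne_map_eq_of_infinite fun n => f^[n] x
  wlog hlt : m < n generalizing m n
  · exact this n m hmn.symm h.symm (by omega)
  refine ⟨_, ⟨n - m, by omega, ?_⟩, m, rfl⟩
  change f^[n - m] (f^[m] x) = f^[m] x
  rw [← iterate_add_apply, Nat.sub_add_cancel hlt.le]
  exact h.symm

theorem exists_periodic_iterate_congr {α : Type} (f : α → α) (x : α) :
    (fun y => y ∈ periodicPts f ∧ ∃ n, f^[n] (f x) = y) =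
      fun y => y ∈ periodicPts f ∧ ∃ n, f^[n] x = y := by
  ext y
  refine and_congr_right fun hy => ⟨fun ⟨n, hn⟩ => ⟨n + 1, hn⟩, ?_⟩
  rintro ⟨n, rfl⟩
  obtain ⟨p, hp, hper⟩ := hy
  refine ⟨p - 1 + n, ?_⟩
  rw [← iterate_succ_apply, show (p - 1 + n).succ = p + n by omega, iterate_add_apply]
  exact hper

theorem minimalPeriod_dvd_sub {α : Type} {f : α → α} {x y : α} {m n : ℕ}
    (hm : f^[m] x = y) (hn : f^[n] x = y) : (minimalPeriod f y : ℤ) ∣ m - n := by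
  wlog hle : n ≤ m generalizing m n
  · rw [← dvd_neg, neg_sub]
    exact this hn hm (by omega)
  rw [← Nat.cast_sub hle, Int.natCast_dvd_natCast]
  apply IsPeriodicPt.minimalPeriod_dvd
  change f^[m - n] y = y
  nth_rw 1 [← hn]
  rw [← iterate_add_apply, Nat.sub_add_cancel hle, hm]

/-- On each component, a system without fixpoints maps to a nontrivial cycle. -/
theorem exists_phase {α : Type} [Finite α] {f : α → α} (hf : ∀ a, f a ≠ a) :
    ∃ (r : α → α) (m : α → ℕ) (φ : α → ℤ), (∀ x, r (f x) = r x) ∧ (∀ i, 2 ≤ m i) ∧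
      ∀ x, (φ (f x) : ZMod (m (r x))) = φ x + 1 := by
  have hω := exists_periodic_iterate f
  let r : α → α := fun x =>
    @Classical.epsilon α ⟨x⟩ fun y => y ∈ periodicPts f ∧ ∃ n, f^[n] x = y
  have hr : ∀ x, r x ∈ periodicPts f ∧ ∃ n, f^[n] x = r x := fun x =>
    Classical.epsilon_spec (hω x)
  have hrf : ∀ x, r (f x) = r x := fun x => by
    simp only [r, exists_periodic_iterate_congr]
  choose n hn using fun x => (hr x).2
  refine ⟨r, fun i => max 2 (minimalPeriod f i), fun x => -n x, hrf, fun i => le_max_left _ _,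
    fun x => ?_⟩
  have h2 : 2 ≤ minimalPeriod f (r x) := by
    have h0 := minimalPeriod_pos_of_mem_periodicPts (hr x).1
    have h1 : minimalPeriod f (r x) ≠ 1 := fun h => hf _ (minimalPeriod_eq_one_iff_isFixedPt.1 h)
    omega
  beta_reduce
  rw [max_eq_right h2]
  have hd := minimalPeriod_dvd_sub (m := n (f x) + 1) (n := n x) ((hn (f x)).trans (hrf x)) (hn x)
  rw [← ZMod.intCast_zmod_eq_zero_iff_dvd] at hd
  push_cast at hd ⊢
  linear_combination -hd

section Twist

variable {α : Type} (m : α → ℕ)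

/-- Rotate those coordinates of a product of cycles that are switched on. -/
def rotate (s : (α → ZMod 2) × (∀ i, ZMod (m i))) : (α → ZMod 2) × (∀ i, ZMod (m i)) :=
  (s.1, fun i => s.2 i + ((s.1 i).val : ℤ))

/-- The part of `rotate` where the number of switched-on coordinates has parity `c`. -/
def rotateParity [Fintype α] (c : ZMod 2)
    (s : {s : (α → ZMod 2) × (∀ i, ZMod (m i)) // ∑ i, s.1 i = c}) :
    {s : (α → ZMod 2) × (∀ i, ZMod (m i)) // ∑ i, s.1 i = c} :=
  ⟨rotate m s.1, s.2⟩

/-- Toggle the switch of coordinate `i` and shift that coordinate by `± t`. -/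
def twist [DecidableEq α] (i : α) (t : ℤ) (s : (α → ZMod 2) × (∀ i, ZMod (m i))) :
    (α → ZMod 2) × (∀ i, ZMod (m i)) :=
  (fun j => s.1 j + if j = i then 1 else 0,
    fun j => s.2 j + if j = i then ((1 - 2 * ((s.1 j).val : ℤ)) * t : ℤ) else 0)

theorem val_add_one_zmod_two (b : ZMod 2) : ((b + 1).val : ℤ) = 1 - b.val := by
  revert b; decide

theorem twist_twist [DecidableEq α] (i : α) (t : ℤ) (s : (α → ZMod 2) × (∀ i, ZMod (m i))) :
    twist m i t (twist m i t s) = s := by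
  refine Prod.ext (funext fun j => ?_) (funext fun j => ?_)
  · by_cases h : j = i
    · simp only [twist, h, if_true]
      generalize s.1 i = b
      revert b; decide
    · simp [twist, h]
  · by_cases h : j = i
    · simp only [twist, h, if_true, val_add_one_zmod_two]
      push_cast
      ring
    · simp [twist, h]

theorem sum_twist [Fintype α] [DecidableEq α] (i : α) (t : ℤ)
    (s : (α → ZMod 2) × (∀ i, ZMod (m i))) :
    ∑ j, (twist m i t s).1 j = ∑ j, s.1 j + 1 := by
  simp [twist, Finset.sum_add_distrib]

theorem twist_rotate [DecidableEq α] {i : α} {t t' : ℤ} (ht : (t' : ZMod (m i)) = t + 1)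
    (s : (α → ZMod 2) × (∀ i, ZMod (m i))) :
    twist m i t' (rotate m s) = rotate m (twist m i t s) := by
  refine Prod.ext rfl (funext fun j => ?_)
  by_cases h : j = i
  · subst h
    simp only [twist, rotate, if_true, val_add_one_zmod_two]
    push_cast
    rw [ht]
    ring
  · simp [twist, rotate, h]

theorem prod_rotateParity_iso [Fintype α] {f : α → α} {r : α → α} {φ : α → ℤ}
    (hr : ∀ x, r (f x) = r x) (hφ : ∀ x, (φ (f x) : ZMod (m (r x))) = φ x + 1) :
    FDSIso (Prod.map f (rotateParity m 0)) (Prod.map f (rotateParity m 1)) := by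
  classical
  refine ⟨⟨fun p => (p.1, ⟨twist m (r p.1) (φ p.1) p.2.1, ?_⟩),
    fun p => (p.1, ⟨twist m (r p.1) (φ p.1) p.2.1, ?_⟩), fun p => ?_, fun p => ?_⟩, fun p => ?_⟩
  · rw [sum_twist, p.2.2, zero_add]
  · rw [sum_twist, p.2.2]
    rfl
  · simp only [twist_twist]
  · simp only [twist_twist]
  · refine Prod.ext rfl (Subtype.ext ?_)
    change twist m (r (f p.1)) (φ (f p.1)) (rotate m p.2.1) =
      rotate m (twist m (r p.1) (φ p.1) p.2.1)
    rw [hr]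
    exact twist_rotate m (hφ p.1) _

theorem not_rotateParity_iso [Fintype α] (hm : ∀ i, 2 ≤ m i) :
    ¬ FDSIso (rotateParity m 0) (rotateParity m 1) := by
  rintro ⟨e, he⟩
  have hfix : rotateParity m 0 ⟨0, by simp⟩ = ⟨0, by simp⟩ := by
    refine Subtype.ext (Prod.ext rfl (funext fun i => ?_))
    simp [rotateParity, rotate]
  have h := he ⟨0, by simp⟩
  rw [hfix] at h
  generalize e ⟨0, by simp⟩ = s at h
  obtain ⟨⟨S, z⟩, hS⟩ := s
  obtain ⟨i, -, hi⟩ := Finset.exists_ne_zero_of_sum_ne_zero (hS.trans_ne one_ne_zero)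
  have hi1 : S i = 1 := by
    change S i ≠ 0 at hi
    generalize S i = b at hi
    revert b; decide
  have : Fact (1 < m i) := ⟨hm i⟩
  have hz : z i = z i + (((S i).val : ℤ) : ZMod (m i)) := congrFun (congrArg (fun s => s.1.2) h) i
  rw [hi1, ZMod.val_one] at hz
  simp at hz

end Twist

end FDS

/-- An FDS on a finite set is cancellative if and only if it has a fixpoint. -/
theorem fds_cancellative_iff_fixpoint (α : Type) [Fintype α] (f : α → α) :
    (∀ (β γ : Type) [Fintype β] [Fintype γ] (g : β → β) (h : γ → γ),
        FDSIso (Prod.map f g) (Prod.map f h) → FDSIso g h)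
      ↔ ∃ a, f a = a := by
  refine ⟨fun H => ?_, fun ⟨a, ha⟩ β γ _ _ g h => FDS.iso_of_prod_iso ha⟩
  by_contra! hf
  obtain ⟨r, m, φ, hr, hm, hφ⟩ := FDS.exists_phase hf
  have (i : α) : NeZero (m i) := ⟨by have := hm i; omega⟩
  have (c : ZMod 2) : Fintype {s : (α → ZMod 2) × (∀ i, ZMod (m i)) // ∑ i, s.1 i = c} :=
    Fintype.ofFinite _
  exact FDS.not_rotateParity_iso m hm (H _ _ _ _ (FDS.prod_rotateParity_iso m hr hφ))
end

section
/- Let f : α → α be an FDS on a finite nonempty set α, and let g : β → β and h : γ → γ be connected FDSs on finite sets. If f × g is isomorphic to f × h, then g is isomorphic to h. -/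
/-- An FDS is connected if its state set is nonempty and any two states have iterates
that meet (i.e. its functional graph is connected). -/
def FDSConnected {α : Type} (f : α → α) : Prop :=
  Nonempty α ∧ ∀ x y : α, ∃ m n : ℕ, f^[m] x = f^[n] y

open Function

/-- The morphisms of dynamical systems from `k` to `f`. -/
def FDSHom {ζ α : Type} (k : ζ → ζ) (f : α → α) : Type :=
  {φ : ζ → α // Semiconj φ k f}

/-- The injective morphisms of dynamical systems from `k` to `f`. -/
def FDSEmb {ζ α : Type} (k : ζ → ζ) (f : α → α) : Type :=
  {φ : FDSHom k f // Injective φ.1}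

/-- The equivalence relations compatible with a dynamical system. -/
def FDSCon {ζ : Type} (k : ζ → ζ) : Type :=
  {s : Setoid ζ // ∀ a b, s a b → s (k a) (k b)}

instance {ζ α : Type} [Finite ζ] [Finite α] (k : ζ → ζ) (f : α → α) : Finite (FDSHom k f) :=
  Subtype.finite

instance {ζ α : Type} [Finite ζ] [Finite α] (k : ζ → ζ) (f : α → α) : Finite (FDSEmb k f) :=
  Subtype.finite

instance {ζ : Type} [Finite ζ] (k : ζ → ζ) : Finite (FDSCon k) := by
  have : Finite (Setoid ζ) :=
    Finite.of_injective (fun s : Setoid ζ => (s : ζ → ζ → Prop)) fun _ _ h =>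
      Setoid.ext fun a b => iff_of_eq (congrFun (congrFun h a) b)
  exact Subtype.finite

namespace FDSCon

variable {ζ α : Type} {k : ζ → ζ} {f : α → α}

/-- The quotient of a dynamical system by a compatible equivalence relation. -/
def quotMap (s : FDSCon k) : Quotient s.1 → Quotient s.1 :=
  Quotient.map k s.2

/-- The kernel of a morphism. -/
def ker (φ : FDSHom k f) : FDSCon k :=
  ⟨Setoid.ker φ.1, fun a b h => by
    rw [Setoid.ker_def] at h ⊢
    rw [φ.2 a, φ.2 b, h]⟩

/-- Equality as a compatible equivalence relation. -/
def eqCon (k : ζ → ζ) : FDSCon k :=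
  ⟨⊥, fun _ _ h => congrArg k h⟩

/-- Morphisms with kernel `s` are the embeddings of the quotient by `s`. -/
def kerFiberEquiv (s : FDSCon k) (f : α → α) :
    {φ : FDSHom k f // ker φ = s} ≃ FDSEmb s.quotMap f where
  toFun φ :=
    have hs : ∀ a b, s.1 a b ↔ φ.1.1 a = φ.1.1 b := fun a b =>
      (Setoid.ext_iff.1 (congrArg Subtype.val φ.2) a b).symm.trans Setoid.ker_def
    ⟨⟨Quotient.lift φ.1.1 fun a b h => (hs a b).1 h,
      fun q => Quotient.inductionOn q fun a => φ.1.2 a⟩,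
      fun p q => Quotient.inductionOn₂ p q fun a b h => Quotient.sound ((hs a b).2 h)⟩
  invFun ψ := ⟨⟨fun a => ψ.1.1 (Quotient.mk _ a), fun a => ψ.1.2 (Quotient.mk _ a)⟩, by
    refine Subtype.ext (Setoid.ext fun a b => ?_)
    exact (Setoid.ker_def.trans ψ.2.eq_iff).trans Quotient.eq⟩
  left_inv _ := rfl
  right_inv ψ := Subtype.ext (Subtype.ext (funext fun q => Quotient.inductionOn q fun _ => rfl))

theorem ker_eq_eqCon_iff (φ : FDSHom k f) : ker φ = eqCon k ↔ Injective φ.1 :=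
  Subtype.ext_iff.trans (Setoid.injective_iff_ker_bot φ.1).symm

theorem card_quotient_lt [Finite ζ] {s : FDSCon k} (hs : s ≠ eqCon k) :
    Nat.card (Quotient s.1) < Nat.card ζ := by
  have hsurj : Surjective (Quotient.mk s.1) := Quotient.mk_surjective
  refine lt_of_le_of_ne (Nat.card_le_card_of_surjective _ hsurj) fun hcard => hs ?_
  have hinj := ((Nat.bijective_iff_surjective_and_card _).2 ⟨hsurj, hcard.symm⟩).injective
  refine Subtype.ext (Setoid.ext fun a b => ⟨fun h => hinj (Quotient.sound h), ?_⟩)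
  rintro (rfl : a = b)
  exact s.1.refl a

end FDSCon

theorem card_fdsHom_eq_sum {ζ α : Type} [Finite ζ] [Finite α] (k : ζ → ζ) (f : α → α)
    [Fintype (FDSCon k)] :
    Nat.card (FDSHom k f) =
      ∑ s : FDSCon k, Nat.card {φ : FDSHom k f // FDSCon.ker φ = s} := by
  rw [← Nat.card_sigma]
  exact Nat.card_congr (Equiv.sigmaFiberEquiv FDSCon.ker).symm

theorem fdsIso_of_injective {α β : Type} [Finite β] {f : α → α} {g : β → β}
    {φ : α → β} (hφ : Semiconj φ f g) (hinj : Injective φ) (hcard : Nat.card α = Nat.card β) :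
    FDSIso f g :=
  ⟨Equiv.ofBijective φ ((Nat.bijective_iff_injective_and_card φ).2 ⟨hinj, hcard⟩), hφ⟩

section Lovasz

variable {α β : Type} [Finite α] [Finite β] {f : α → α} {g : β → β}

theorem card_fdsEmb_eq
    (H : ∀ (ζ : Type) [Finite ζ] (k : ζ → ζ), Nat.card (FDSHom k f) = Nat.card (FDSHom k g))
    (ζ : Type) [Finite ζ] (k : ζ → ζ) : Nat.card (FDSEmb k f) = Nat.card (FDSEmb k g) := by
  classical
  induction hn : Nat.card ζ using Nat.strong_induction_on generalizing ζ with
  | _ n ih =>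
    subst hn
    have := Fintype.ofFinite (FDSCon k)
    have hsum := H ζ k
    rw [card_fdsHom_eq_sum, card_fdsHom_eq_sum,
      ← Finset.add_sum_erase _ _ (Finset.mem_univ (FDSCon.eqCon k)),
      ← Finset.add_sum_erase _ _ (Finset.mem_univ (FDSCon.eqCon k)),
      Finset.sum_congr rfl fun s hs => ?_] at hsum
    · have h := Nat.add_right_cancel hsum
      simpa only [FDSCon.ker_eq_eqCon_iff] using! h
    · rw [Nat.card_congr (s.kerFiberEquiv f), Nat.card_congr (s.kerFiberEquiv g)]
      exact ih _ (FDSCon.card_quotient_lt (Finset.ne_of_mem_erase hs)) _ _ rfl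

/-- Lovász's theorem: a finite dynamical system is determined by its numbers of
incoming morphisms. -/
theorem fdsIso_of_card_fdsHom_eq
    (H : ∀ (ζ : Type) [Finite ζ] (k : ζ → ζ), Nat.card (FDSHom k f) = Nat.card (FDSHom k g)) :
    FDSIso f g := by
  have hf : Nonempty (FDSEmb f f) := ⟨⟨⟨id, Semiconj.id_left⟩, injective_id⟩⟩
  have hg : Nonempty (FDSEmb g g) := ⟨⟨⟨id, Semiconj.id_left⟩, injective_id⟩⟩
  rw [← Finite.card_pos_iff, card_fdsEmb_eq H, Finite.card_pos_iff] at hf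
  rw [← Finite.card_pos_iff, ← card_fdsEmb_eq H, Finite.card_pos_iff] at hg
  obtain ⟨φ, hφ⟩ := hf
  obtain ⟨ψ, hψ⟩ := hg
  exact fdsIso_of_injective φ.2 hφ
    ((Nat.card_le_card_of_injective _ hφ).antisymm (Nat.card_le_card_of_injective _ hψ))

end Lovasz

/-- Morphisms to a product are pairs of morphisms. -/
def fdsHomProdEquiv {ζ α β : Type} (k : ζ → ζ) (f : α → α) (g : β → β) :
    FDSHom k (Prod.map f g) ≃ FDSHom k f × FDSHom k g where
  toFun φ := (⟨fun z => (φ.1 z).1, fun z => congrArg Prod.fst (φ.2 z)⟩,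
    ⟨fun z => (φ.1 z).2, fun z => congrArg Prod.snd (φ.2 z)⟩)
  invFun φ := ⟨fun z => (φ.1.1 z, φ.2.1 z), fun z => Prod.ext (φ.1.2 z) (φ.2.2 z)⟩
  left_inv _ := rfl
  right_inv _ := rfl

theorem card_fdsHom_prodMap {ζ α β : Type} (k : ζ → ζ) (f : α → α) (g : β → β) :
    Nat.card (FDSHom k (Prod.map f g)) = Nat.card (FDSHom k f) * Nat.card (FDSHom k g) := by
  rw [Nat.card_congr (fdsHomProdEquiv k f g), Nat.card_prod]

theorem FDSIso.card_fdsHom_eq {α β : Type} {f : α → α} {g : β → β} (h : FDSIso f g)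
    {ζ : Type} (k : ζ → ζ) : Nat.card (FDSHom k f) = Nat.card (FDSHom k g) := by
  obtain ⟨e, he⟩ := h
  have he' : Semiconj e.symm g f := fun y => by rw [Equiv.symm_apply_eq, he, e.apply_symm_apply]
  exact Nat.card_congr
    { toFun := fun φ => ⟨e ∘ φ.1, Semiconj.trans φ.2 he⟩
      invFun := fun φ => ⟨e.symm ∘ φ.1, Semiconj.trans φ.2 he'⟩
      left_inv := fun φ => Subtype.ext (funext fun z => e.symm_apply_apply _)
      right_inv := fun φ => Subtype.ext (funext fun z => e.apply_symm_apply _) }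

/-- A factor of a product can be replaced by any finite system mapping to it. -/
theorem FDSIso.prodMap_of_fdsHom {α β γ δ : Type} [Finite α] [Finite β] [Finite γ] [Finite δ]
    {f : α → α} {g : β → β} {h : γ → γ} {c : δ → δ} (φ : FDSHom c f)
    (hiso : FDSIso (Prod.map f g) (Prod.map f h)) :
    FDSIso (Prod.map c g) (Prod.map c h) := by
  refine fdsIso_of_card_fdsHom_eq fun ζ _ k => ?_
  rw [card_fdsHom_prodMap, card_fdsHom_prodMap]
  rcases isEmpty_or_nonempty (FDSHom k c) with hc | ⟨⟨ψ⟩⟩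
  · simp
  · have : Nonempty (FDSHom k f) := ⟨⟨φ.1 ∘ ψ.1, Semiconj.trans ψ.2 φ.2⟩⟩
    have hk := hiso.card_fdsHom_eq k
    rw [card_fdsHom_prodMap, card_fdsHom_prodMap] at hk
    rw [Nat.eq_of_mul_eq_mul_left Nat.card_pos hk]

theorem periodicPts_nonempty {α : Type} [Finite α] [Nonempty α] (f : α → α) :
    (periodicPts f).Nonempty := by
  obtain ⟨x⟩ := ‹Nonempty α›
  obtain ⟨m, n, heq, hne⟩ : ∃ m n, f^[m] x = f^[n] x ∧ m ≠ n := by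
    simpa [Injective] using not_injective_infinite_finite (f^[·] x)
  wlog hlt : m < n generalizing m n
  · exact this n m heq.symm hne.symm (by omega)
  refine ⟨f^[m] x, n - m, by omega, ?_⟩
  rw [IsPeriodicPt, IsFixedPt, ← iterate_add_apply, Nat.sub_add_cancel hlt.le, heq]

theorem exists_fdsHom_zmod {α : Type} [Finite α] [Nonempty α] (f : α → α) :
    ∃ (L : ℕ) (_ : NeZero L), Nonempty (FDSHom (fun i : ZMod L => i + 1) f) := by
  obtain ⟨a, L, hL, ha⟩ := periodicPts_nonempty f
  have : NeZero L := ⟨hL.ne'⟩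
  refine ⟨L, this, ⟨fun i => f^[i.val] a, fun i => ?_⟩⟩
  change f^[(i + 1).val] a = f (f^[i.val] a)
  rw [← iterate_succ_apply' f, ZMod.val_add, ha.iterate_mod_apply, ZMod.val_one_eq_one_mod,
    ← ha.iterate_mod_apply, Nat.add_mod_mod, ha.iterate_mod_apply]

theorem FDSConnected.exists_lt_iterate_eq {β : Type} {g : β → β} (hg : FDSConnected g)
    {x₀ x : β} (h₀ : x₀ ∈ periodicPts g) (hx : x ∈ periodicPts g) :
    ∃ n < minimalPeriod g x₀, g^[n] x₀ = x := by
  obtain ⟨N, hN, hNx⟩ := hx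
  obtain ⟨m, n, hmn⟩ := hg.2 x x₀
  refine ⟨_, Nat.mod_lt (N * m - m + n) (minimalPeriod_pos_of_mem_periodicPts h₀), ?_⟩
  rw [iterate_mod_minimalPeriod_eq, iterate_add_apply, ← hmn, ← iterate_add_apply,
    Nat.sub_add_cancel (Nat.le_mul_of_pos_left m hN)]
  exact hNx.mul_const m

theorem iterate_mem_periodicPts {β : Type} {g : β → β} {x : β} (hx : x ∈ periodicPts g) (n : ℕ) :
    g^[n] x ∈ periodicPts g := by
  obtain ⟨N, hN, h⟩ := hx
  exact ⟨N, hN, h.apply_iterate n⟩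

theorem FDSConnected.ncard_periodicPts {β : Type} {g : β → β} (hg : FDSConnected g)
    {x₀ : β} (h₀ : x₀ ∈ periodicPts g) : (periodicPts g).ncard = minimalPeriod g x₀ := by
  have himage : (g^[·] x₀) '' Set.Iio (minimalPeriod g x₀) = periodicPts g := by
    ext x
    refine ⟨?_, fun hx => hg.exists_lt_iterate_eq h₀ hx⟩
    rintro ⟨n, -, rfl⟩
    exact iterate_mem_periodicPts h₀ n
  rw [← himage, iterate_injOn_Iio_minimalPeriod.ncard_image]
  simp

section Cover

variable {β γ : Type} {g : β → β} {h : γ → γ} {L : ℕ}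

theorem iterate_prodMap_add_one (n : ℕ) (i : ZMod L) (x : β) :
    (Prod.map (fun i : ZMod L => i + 1) g)^[n] (i, x) = (i + n, g^[n] x) := by
  rw [Prod.map_iterate, Prod.map_apply, add_right_iterate_apply, nsmul_one]

theorem mem_periodicPts_prodMap_add_one [NeZero L] (i : ZMod L) (x : β) :
    (i, x) ∈ periodicPts (Prod.map (fun i : ZMod L => i + 1) g) ↔ x ∈ periodicPts g := by
  constructor
  · rintro ⟨n, hn, hp⟩
    exact ⟨n, hn, ((isPeriodicPt_prodMap _).1 hp).2⟩
  · rintro ⟨n, hn, hp⟩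
    refine ⟨L * n, Nat.mul_pos (NeZero.pos L) hn, ?_⟩
    rw [IsPeriodicPt, IsFixedPt, iterate_prodMap_add_one, (hp.const_mul L).eq]
    simp

theorem mem_periodicPts_iff_of_equiv {α β : Type} {f : α → α} {g : β → β} {e : α ≃ β}
    (he : Semiconj e f g) (x : α) : e x ∈ periodicPts g ↔ x ∈ periodicPts f := by
  have (n : ℕ) : IsPeriodicPt g n (e x) ↔ IsPeriodicPt f n x := by
    rw [IsPeriodicPt, IsPeriodicPt, IsFixedPt, IsFixedPt, ← (he.iterate_right n).eq,
      e.injective.eq_iff]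
  simp only [mem_periodicPts, this]

theorem ncard_periodicPts_eq [NeZero L]
    (hiso : FDSIso (Prod.map (fun i : ZMod L => i + 1) g) (Prod.map (fun i : ZMod L => i + 1) h)) :
    (periodicPts g).ncard = (periodicPts h).ncard := by
  obtain ⟨e, he⟩ := hiso
  have hcard {δ : Type} (c : δ → δ) : (periodicPts (Prod.map (fun i : ZMod L => i + 1) c)).ncard =
      L * (periodicPts c).ncard := by
    have hprod : periodicPts (Prod.map (fun i : ZMod L => i + 1) c) =
        Set.univ ×ˢ periodicPts c := by
      ext ⟨i, x⟩
      simp [mem_periodicPts_prodMap_add_one]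
    rw [hprod, Set.ncard_prod, Set.ncard_univ, Nat.card_zmod]
  refine Nat.eq_of_mul_eq_mul_left (NeZero.pos L) ?_
  rw [← hcard, ← hcard, ← Set.ncard_image_of_injective _ e.injective]
  congr 1
  ext y
  rw [e.image_eq_preimage_symm, Set.mem_preimage, ← mem_periodicPts_iff_of_equiv he,
    e.apply_symm_apply]

/-- The first periodic state reached from `x` is reached after `d` steps, and it is the `k`-th state
of the cycle starting at `x₀`. -/
structure HasRoot (g : β → β) (x₀ x : β) (d k : ℕ) : Prop where
  lt : k < minimalPeriod g x₀
  eq : g^[d] x = g^[k] x₀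
  notMem : ∀ j < d, g^[j] x ∉ periodicPts g

theorem FDSConnected.exists_hasRoot (hg : FDSConnected g) {x₀ : β} (h₀ : x₀ ∈ periodicPts g)
    (x : β) : ∃ d k, HasRoot g x₀ x d k := by
  classical
  have hex : ∃ d, g^[d] x ∈ periodicPts g := by
    obtain ⟨m, n, hmn⟩ := hg.2 x x₀
    exact ⟨m, hmn ▸ iterate_mem_periodicPts h₀ n⟩
  obtain ⟨k, hk, hkx⟩ := hg.exists_lt_iterate_eq h₀ (Nat.find_spec hex)
  exact ⟨Nat.find hex, k, hk, hkx.symm, fun j hj => Nat.find_min hex hj⟩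

theorem HasRoot.unique {x₀ x : β} {d k d' k' : ℕ} (h₀ : x₀ ∈ periodicPts g)
    (hr : HasRoot g x₀ x d k) (hr' : HasRoot g x₀ x d' k') : d = d' ∧ k = k' := by
  have hd : d = d' := by
    rcases lt_trichotomy d d' with hlt | heq | hlt
    · exact (hr'.notMem d hlt (hr.eq ▸ iterate_mem_periodicPts h₀ k)).elim
    · exact heq
    · exact (hr.notMem d' hlt (hr'.eq ▸ iterate_mem_periodicPts h₀ k')).elim
  subst hd
  exact ⟨rfl, (iterate_eq_iterate_iff_of_lt_minimalPeriod hr.lt hr'.lt).1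
    (hr.eq.symm.trans hr'.eq)⟩

theorem HasRoot.apply {x₀ x : β} {d k : ℕ} (hr : HasRoot g x₀ x (d + 1) k) :
    HasRoot g x₀ (g x) d k :=
  ⟨hr.lt, hr.eq, fun j hj => hr.notMem (j + 1) (by omega)⟩

variable {e : ZMod L × β ≃ ZMod L × γ} {x₀ x : β} {y₀ : γ} {d k : ℕ}

theorem apply_cycle_eq
    (he : Semiconj e (Prod.map (fun i : ZMod L => i + 1) g) (Prod.map (fun i : ZMod L => i + 1) h))
    (h₀ : e (0, x₀) = (0, y₀)) (k : ℕ) : e ((k : ZMod L), g^[k] x₀) = ((k : ZMod L), h^[k] y₀) := by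
  have := (he.iterate_right k).eq (0, x₀)
  simpa only [h₀, iterate_prodMap_add_one, zero_add] using this

theorem apply_iterate_eq
    (he : Semiconj e (Prod.map (fun i : ZMod L => i + 1) g) (Prod.map (fun i : ZMod L => i + 1) h))
    (n : ℕ) (i : ZMod L) (x : β) :
    e (i + n, g^[n] x) = ((e (i, x)).1 + n, h^[n] (e (i, x)).2) := by
  have := (he.iterate_right n).eq (i, x)
  rwa [iterate_prodMap_add_one, ← Prod.mk.eta (p := e (i, x)), iterate_prodMap_add_one] at this

theorem HasRoot.fst_apply
    (he : Semiconj e (Prod.map (fun i : ZMod L => i + 1) g) (Prod.map (fun i : ZMod L => i + 1) h))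
    (h₀ : e (0, x₀) = (0, y₀)) (hr : HasRoot g x₀ x d k) :
    (e ((k : ZMod L) - d, x)).1 = k - d := by
  have := apply_iterate_eq he d ((k : ZMod L) - d) x
  rw [sub_add_cancel, hr.eq, apply_cycle_eq he h₀] at this
  exact eq_sub_of_add_eq (Prod.ext_iff.1 this).1.symm

theorem HasRoot.map [NeZero L]
    (he : Semiconj e (Prod.map (fun i : ZMod L => i + 1) g) (Prod.map (fun i : ZMod L => i + 1) h))
    (h₀ : e (0, x₀) = (0, y₀)) (hp : minimalPeriod g x₀ = minimalPeriod h y₀)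
    (hr : HasRoot g x₀ x d k) : HasRoot h y₀ (e ((k : ZMod L) - d, x)).2 d k where
  lt := hp ▸ hr.lt
  eq := by
    have := apply_iterate_eq he d ((k : ZMod L) - d) x
    rw [sub_add_cancel, hr.eq, apply_cycle_eq he h₀] at this
    exact (Prod.ext_iff.1 this).2.symm
  notMem j hj := by
    rw [← mem_periodicPts_prodMap_add_one ((e ((k : ZMod L) - d, x)).1 + (j : ZMod L)),
      ← apply_iterate_eq he, mem_periodicPts_iff_of_equiv he, mem_periodicPts_prodMap_add_one]
    exact hr.notMem j hj

/-- Connected systems whose products with a cycle are isomorphic, by an isomorphism matching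
base points on their cycles, are isomorphic. -/
theorem fdsIso_of_prodMap_add_one [NeZero L] [Finite β] [Finite γ] (hg : FDSConnected g)
    (he : Semiconj e (Prod.map (fun i : ZMod L => i + 1) g) (Prod.map (fun i : ZMod L => i + 1) h))
    (h₀ : e (0, x₀) = (0, y₀)) (hx₀ : x₀ ∈ periodicPts g)
    (hp : minimalPeriod g x₀ = minimalPeriod h y₀) : FDSIso g h := by
  choose d k hr using hg.exists_hasRoot hx₀
  have hy₀ : y₀ ∈ periodicPts h := by
    rwa [← minimalPeriod_pos_iff_mem_periodicPts, ← hp, minimalPeriod_pos_iff_mem_periodicPts]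
  have hcard : Nat.card β = Nat.card γ := by
    have := Nat.card_congr e
    rw [Nat.card_prod, Nat.card_prod, Nat.card_zmod] at this
    exact Nat.eq_of_mul_eq_mul_left (NeZero.pos L) this
  refine fdsIso_of_injective (φ := fun x => (e ((k x : ZMod L) - d x, x)).2)
    (fun x => ?_) (fun x x' (hxx' : (e (_, x)).2 = (e (_, x')).2) => ?_) hcard
  · change (e ((k (g x) : ZMod L) - d (g x), g x)).2 = h (e ((k x : ZMod L) - d x, x)).2
    have hstep := (apply_iterate_eq he 1 ((k x : ZMod L) - d x) x)
    rw [iterate_one, iterate_one] at hstep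
    rcases hd : d x with _ | n
    · have hx : HasRoot g x₀ x 0 (k x) := hd ▸ hr x
      have hx_eq : x = g^[k x] x₀ := hx.eq
      have hgx : HasRoot g x₀ (g x) 0 ((k x + 1) % minimalPeriod g x₀) :=
        ⟨Nat.mod_lt _ (minimalPeriod_pos_of_mem_periodicPts hx₀), by
          rw [iterate_mod_minimalPeriod_eq, iterate_succ_apply', ← hx_eq, iterate_zero_apply],
          fun j hj => (Nat.not_lt_zero j hj).elim⟩
      have h1 := ((hr x).map he h₀ hp).eq
      have h2 := ((hr (g x)).map he h₀ hp).eq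
      obtain ⟨hd', hk'⟩ := (hr (g x)).unique hx₀ hgx
      rw [hd, iterate_zero_apply] at h1
      rw [hd', hk', iterate_zero_apply, hp, iterate_mod_minimalPeriod_eq] at h2
      rw [hd', hk', hp, h1, h2, iterate_succ_apply']
    · have hx : HasRoot g x₀ x (n + 1) (k x) := hd ▸ hr x
      obtain ⟨hd', hk'⟩ := (hr (g x)).unique hx₀ hx.apply
      have hi : (k x : ZMod L) - (n + 1 : ℕ) + (1 : ℕ) = k x - n := by push_cast; ring
      rw [hd, hi] at hstep
      rw [hd', hk', hstep]
  · have hx := (hr x).map he h₀ hp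
    have hx' := (hr x').map he h₀ hp
    obtain ⟨hd, hk⟩ := (show HasRoot h y₀ _ (d x) (k x) from hxx' ▸ hx).unique hy₀ hx'
    have hfst := (hr x).fst_apply he h₀
    have hfst' := (hr x').fst_apply he h₀
    have := e.injective (Prod.ext (hfst.trans (by rw [hd, hk, hfst'])) hxx')
    exact (Prod.ext_iff.1 this).2

theorem fdsIso_of_fdsIso_prodMap_add_one [NeZero L] [Finite β] [Finite γ]
    (hg : FDSConnected g) (hh : FDSConnected h)
    (hiso : FDSIso (Prod.map (fun i : ZMod L => i + 1) g) (Prod.map (fun i : ZMod L => i + 1) h)) :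
    FDSIso g h := by
  have hcard := ncard_periodicPts_eq hiso
  obtain ⟨e, he⟩ := hiso
  have := hg.1
  obtain ⟨x₀, hx₀⟩ := periodicPts_nonempty g
  obtain ⟨⟨j, y₀⟩, hj⟩ : ∃ z, e (0, x₀) = z := ⟨_, rfl⟩
  have hy₀ : y₀ ∈ periodicPts h := by
    rwa [← mem_periodicPts_prodMap_add_one j, ← hj, mem_periodicPts_iff_of_equiv he,
      mem_periodicPts_prodMap_add_one]
  refine fdsIso_of_prodMap_add_one (L := L) (x₀ := x₀) (y₀ := y₀)
    (e := e.trans ((Equiv.subRight j).prodCongr (Equiv.refl γ))) hg (fun z => ?_) ?_ hx₀ ?_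
  · ext
    · simp [he, add_sub_right_comm]
    · simp [he]
  · simp [hj]
  · rw [← hg.ncard_periodicPts hx₀, ← hh.ncard_periodicPts hy₀, hcard]

end Cover

/-- Division by any FDS is unambiguous when the quotients are connected. -/
theorem fds_cancel_of_connected (α β γ : Type) [Fintype α] [Fintype β] [Fintype γ]
    [Nonempty α] (f : α → α) (g : β → β) (h : γ → γ)
    (hg : FDSConnected g) (hh : FDSConnected h)
    (hiso : FDSIso (Prod.map f g) (Prod.map f h)) :
    FDSIso g h := by
  obtain ⟨L, _, ⟨φ⟩⟩ := exists_fdsHom_zmod f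
  exact fdsIso_of_fdsIso_prodMap_add_one hg hh (hiso.prodMap_of_fdsHom φ)
end

section
/- k-th roots of FDSs are unique: let k ≥ 1 and let f : α → α and g : β → β be FDSs on finite sets. If the k-th power f^⊗k is isomorphic to the k-th power g^⊗k, then f is isomorphic to g. -/
/-- Maps into a `k`-th power that intertwine the dynamics are `k`-tuples of maps that do. -/
def semiconjPowEquiv {X α : Type} (s : X → X) (f : α → α) (k : ℕ) :
    {h : X → Fin k → α // Function.Semiconj h s (fun v => f ∘ v)} ≃
      (Fin k → {h : X → α // Function.Semiconj h s f}) where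
  toFun h i := ⟨fun x => h.1 x i, fun x => congrFun (h.2 x) i⟩
  invFun h := ⟨fun x i => (h i).1 x, fun x => funext fun i => (h i).2 x⟩
  left_inv _ := rfl
  right_inv _ := rfl

/-- An isomorphism of targets induces a bijection between the sets of intertwining maps. -/
def semiconjCongr {X α β : Type} (s : X → X) {f : α → α} {g : β → β} (e : α ≃ β)
    (he : ∀ x, e (f x) = g (e x)) :
    {h : X → α // Function.Semiconj h s f} ≃ {h : X → β // Function.Semiconj h s g} :=
  (Equiv.arrowCongr (Equiv.refl X) e).subtypeEquiv
    fun h => by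
      refine forall_congr' fun x => ?_
      simp [← he]

theorem FDSIso.card_semiconj_eq_of_pow {α β : Type} [Finite α] [Finite β] {k : ℕ} (hk : 1 ≤ k)
    {f : α → α} {g : β → β}
    (h : FDSIso (fun v : Fin k → α => f ∘ v) (fun v : Fin k → β => g ∘ v))
    {X : Type} (s : X → X) :
    Nat.card {h : X → α // Function.Semiconj h s f} =
      Nat.card {h : X → β // Function.Semiconj h s g} := by
  obtain ⟨e, he⟩ := h
  have := Nat.card_congr ((semiconjPowEquiv s f k).symm.trans
    ((semiconjCongr s e he).trans (semiconjPowEquiv s g k)))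
  rw [Nat.card_fun, Nat.card_fun, Nat.card_fin] at this
  exact Nat.pow_left_injective (by omega) this

/-- Intertwining maps with kernel a given congruence are the injective intertwining maps on the
quotient. -/
def semiconjKerEquiv {X α : Type} {s : X → X} (f : α → α) (r : Setoid X)
    (hr : ∀ a b, r a b → r (s a) (s b)) :
    {h : {h : X → α // Function.Semiconj h s f} // Setoid.ker h.1 = r} ≃
      {h : Quotient r → α // Function.Semiconj h (Quotient.map s hr) f ∧ Function.Injective h} where
  toFun h := ⟨Quotient.lift h.1.1 fun a b hab => by
      have : Setoid.ker h.1.1 a b := by rw [h.2]; exact hab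
      exact this,
    fun x => Quotient.inductionOn x h.1.2,
    fun x y => Quotient.inductionOn₂ x y fun a b hab => Quotient.sound <| by
      have : Setoid.ker h.1.1 a b := hab
      rw [h.2] at this
      exact this⟩
  invFun h := ⟨⟨fun x => h.1 ⟦x⟧, fun x => h.2.1 ⟦x⟧⟩, Setoid.ext fun _ _ =>
    h.2.2.eq_iff.trans Quotient.eq⟩
  left_inv _ := rfl
  right_inv h := Subtype.ext <| funext fun x => Quotient.inductionOn x fun _ => rfl

/-- Lovász: counts of intertwining maps determine counts of injective intertwining maps. -/
theorem card_injective_semiconj_eq {α β : Type} [Finite α] [Finite β] {f : α → α} {g : β → β}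
    (hfg : ∀ {X : Type} [Finite X] (s : X → X),
      Nat.card {h : X → α // Function.Semiconj h s f} =
        Nat.card {h : X → β // Function.Semiconj h s g})
    {X : Type} [Finite X] (s : X → X) :
    Nat.card {h : X → α // Function.Semiconj h s f ∧ Function.Injective h} =
      Nat.card {h : X → β // Function.Semiconj h s g ∧ Function.Injective h} := by
  classical
  induction hn : Nat.card X using Nat.strong_induction_on generalizing X with
  | _ n ih =>
  have : Finite (Setoid X) := Finite.of_injective (fun r : Setoid X => r.r) fun r t h =>
    Setoid.ext fun a b => iff_of_eq (congrFun (congrFun h a) b)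
  have := Fintype.ofFinite (Setoid X)
  have hinj {γ : Type} (p : γ → γ) :
      Nat.card {h : X → γ // Function.Semiconj h s p ∧ Function.Injective h} =
        Nat.card {h : {h : X → γ // Function.Semiconj h s p} // Setoid.ker h.1 = ⊥} :=
    Nat.card_congr <| ((Equiv.subtypeSubtypeEquivSubtypeInter _ _).symm).trans <|
      Equiv.subtypeEquivRight fun h => Setoid.injective_iff_ker_bot h.1
  have hsum {γ : Type} [Finite γ] (p : γ → γ) :
      Nat.card {h : X → γ // Function.Semiconj h s p} =
        ∑ r : Setoid X,
          Nat.card {h : {h : X → γ // Function.Semiconj h s p} // Setoid.ker h.1 = r} := by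
    rw [← Nat.card_sigma]
    exact Nat.card_congr (Equiv.sigmaFiberEquiv _).symm
  have key := hfg s
  rw [hsum f, hsum g, ← Finset.add_sum_erase _ _ (Finset.mem_univ ⊥),
    ← Finset.add_sum_erase _ _ (Finset.mem_univ ⊥), ← hinj, ← hinj] at key
  refine Nat.add_right_cancel (key.trans (congrArg _ (Finset.sum_congr rfl fun r hr => ?_)).symm)
  by_cases hc : ∀ a b, r a b → r (s a) (s b)
  · rw [Nat.card_congr (semiconjKerEquiv f r hc), Nat.card_congr (semiconjKerEquiv g r hc)]
    refine ih _ ?_ _ rfl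
    rw [← hn]
    refine lt_of_le_of_ne (Nat.card_le_card_of_surjective _ Quotient.mk_surjective) fun hcard => ?_
    have hbij := (Nat.bijective_iff_surjective_and_card (Quotient.mk r)).2
      ⟨Quotient.mk_surjective, hcard.symm⟩
    refine Finset.ne_of_mem_erase hr (Setoid.ext fun a b => ?_)
    exact Quotient.eq.symm.trans hbij.1.eq_iff
  · have hempty {γ : Type} (p : γ → γ) :
        IsEmpty {h : {h : X → γ // Function.Semiconj h s p} // Setoid.ker h.1 = r} := by
      refine ⟨fun ⟨⟨h, hh⟩, hr⟩ => hc fun a b hab => ?_⟩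
      subst hr
      have hab' : h a = h b := hab
      change h (s a) = h (s b)
      rw [hh a, hh b, hab']
    have := hempty f
    have := hempty g
    simp only [Nat.card_of_isEmpty]

/-- `k`-th roots of FDSs are unique: if the `k`-th powers (componentwise action on
`Fin k → α`) of two FDSs are isomorphic, then so are the FDSs themselves. -/
theorem fds_kth_root_unique (α β : Type) [Fintype α] [Fintype β]
    (k : ℕ) (hk : 1 ≤ k) (f : α → α) (g : β → β)
    (h : FDSIso (fun v : Fin k → α => f ∘ v) (fun v : Fin k → β => g ∘ v)) :
    FDSIso f g := by
  have hcard {X : Type} [Finite X] (s : X → X) := card_injective_semiconj_eq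
    (fun s => FDSIso.card_semiconj_eq_of_pow hk h s) s
  have hα : 0 < Nat.card {i : α → α // Function.Semiconj i f f ∧ Function.Injective i} :=
    Nat.card_pos_iff.2 ⟨⟨id, fun _ => rfl, Function.injective_id⟩, inferInstance⟩
  have hβ : 0 < Nat.card {i : β → β // Function.Semiconj i g g ∧ Function.Injective i} :=
    Nat.card_pos_iff.2 ⟨⟨id, fun _ => rfl, Function.injective_id⟩, inferInstance⟩
  rw [hcard f] at hα
  rw [← hcard g] at hβ
  obtain ⟨⟨i, hi, hi'⟩⟩ := (Nat.card_pos_iff.1 hα).1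
  obtain ⟨⟨j, -, hj⟩⟩ := (Nat.card_pos_iff.1 hβ).1
  have hbij := (Fintype.bijective_iff_injective_and_card i).2
    ⟨hi', (Fintype.card_le_of_injective i hi').antisymm (Fintype.card_le_of_injective j hj)⟩
  exact ⟨Equiv.ofBijective i hbij, hi⟩
end

section
/- Let 𝒜 be a finite set of integers, each greater than 1. Then there exist finite sets β, γ and bijections g : β → β, h : γ → γ such that g is not isomorphic to h, but for every a ∈ 𝒜 the product C_a × g is isomorphic to C_a × h. -/
namespace FDSIso

variable {α β γ δ : Type} {f : α → α} {g : β → β} {h : γ → γ} {k : δ → δ}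

theorem symm (H : FDSIso f g) : FDSIso g f := by
  obtain ⟨e, he⟩ := H
  exact ⟨e.symm, fun x => by rw [e.symm_apply_eq, he, e.apply_symm_apply]⟩

theorem trans (H : FDSIso f g) (H' : FDSIso g h) : FDSIso f h := by
  obtain ⟨e, he⟩ := H
  obtain ⟨e', he'⟩ := H'
  exact ⟨e.trans e', fun x => by simp [he, he']⟩

theorem prodMap (f : α → α) (H : FDSIso g h) : FDSIso (Prod.map f g) (Prod.map f h) := by
  obtain ⟨e, he⟩ := H
  exact ⟨(Equiv.refl α).prodCongr e, fun x => Prod.ext rfl (he x.2)⟩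

theorem sumMap (H : FDSIso f g) (H' : FDSIso h k) : FDSIso (Sum.map f h) (Sum.map g k) := by
  obtain ⟨e, he⟩ := H
  obtain ⟨e', he'⟩ := H'
  exact ⟨e.sumCongr e', by rintro (x | x) <;> simp [he, he']⟩

theorem sumMap_comm (f : α → α) (g : β → β) : FDSIso (Sum.map f g) (Sum.map g f) :=
  ⟨Equiv.sumComm α β, by rintro (x | x) <;> rfl⟩

theorem prodMap_leftComm (f : α → α) (g : β → β) (h : γ → γ) :
    FDSIso (Prod.map f (Prod.map g h)) (Prod.map g (Prod.map f h)) :=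
  ⟨⟨fun x => (x.2.1, x.1, x.2.2), fun x => (x.2.1, x.1, x.2.2), fun _ => rfl, fun _ => rfl⟩,
    fun _ => rfl⟩

theorem prodMap_sumMap (f : α → α) (g : β → β) (h : γ → γ) :
    FDSIso (Prod.map f (Sum.map g h)) (Sum.map (Prod.map f g) (Prod.map f h)) :=
  ⟨Equiv.prodSumDistrib α β γ, by rintro ⟨x, y | y⟩ <;> rfl⟩

theorem prodMap_prodMap_of_prodMap (k : δ → δ) (H : FDSIso (Prod.map f g) (Prod.map f h)) :
    FDSIso (Prod.map f (Prod.map k g)) (Prod.map f (Prod.map k h)) :=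
  ((prodMap_leftComm f k g).trans (H.prodMap k)).trans (prodMap_leftComm k f h)

/-- The cycle of length `a` turns a second factor `C_a` into `a` disjoint copies. -/
theorem cycle_prodMap_cycle (a : ℕ) (g : β → β) :
    FDSIso (Prod.map (fun x : ZMod a => x + 1) (Prod.map (fun x : ZMod a => x + 1) g))
      (Prod.map (fun x : ZMod a => x + 1) (Prod.map (id : ZMod a → ZMod a) g)) :=
  ⟨⟨fun x => (x.1, x.2.1 - x.1, x.2.2), fun x => (x.1, x.2.1 + x.1, x.2.2),
    fun x => by simp, fun x => by simp⟩, fun x => by simp⟩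

theorem card_fixedPoints_eq (H : FDSIso f g) :
    Nat.card (Function.fixedPoints f) = Nat.card (Function.fixedPoints g) := by
  obtain ⟨e, he⟩ := H
  refine Nat.card_congr (e.subtypeEquiv fun x => ?_)
  simp [Function.mem_fixedPoints, Function.IsFixedPt, ← he]

end FDSIso

/-- In `C_a × g + a · h` only the second summand has fixed points. -/
theorem card_fixedPoints_sumMap_cycle {β γ : Type} {a : ℕ} (ha : 1 < a) (g : β → β) (h : γ → γ) :
    Nat.card (Function.fixedPoints
      (Sum.map (Prod.map (fun x : ZMod a => x + 1) g) (Prod.map (id : ZMod a → ZMod a) h))) =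
      a * Nat.card (Function.fixedPoints h) := by
  have : Fact (1 < a) := ⟨ha⟩
  rw [← Nat.card_zmod a, ← Nat.card_prod, Nat.card_zmod]
  symm
  refine Nat.card_congr (Equiv.ofBijective
    (fun x => ⟨Sum.inr (x.1, x.2.1), congrArg (fun y => Sum.inr (x.1, y)) x.2.2⟩) ⟨?_, ?_⟩)
  · rintro ⟨x, y, hy⟩ ⟨x', y', hy'⟩ hxy
    simpa using congrArg Subtype.val hxy
  · rintro ⟨⟨x, y⟩ | ⟨x, y⟩, hxy⟩
    · simp [Function.mem_fixedPoints, Function.IsFixedPt] at hxy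
    · exact ⟨(x, ⟨y, by simpa [Function.mem_fixedPoints, Function.IsFixedPt] using hxy⟩), rfl⟩

theorem exists_pair_card_fixedPoints_ne (𝒜 : Finset ℕ) (h𝒜 : ∀ a ∈ 𝒜, 1 < a) :
    ∃ (β γ : Type) (_ : Fintype β) (_ : Fintype γ) (g : β → β) (h : γ → γ),
      Function.Bijective g ∧ Function.Bijective h ∧
      Nat.card (Function.fixedPoints g) ≠ Nat.card (Function.fixedPoints h) ∧
      ∀ a ∈ 𝒜,
        FDSIso (Prod.map (fun x : ZMod a => x + 1) g)
               (Prod.map (fun x : ZMod a => x + 1) h) := by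
  induction 𝒜 using Finset.induction_on with
  | empty =>
    refine ⟨Unit, Empty, inferInstance, inferInstance, id, id, Function.bijective_id,
      Function.bijective_id, ?_, by simp⟩
    simp [Function.fixedPoints_id]
  | insert a s _ ih =>
    obtain ⟨β, γ, _, _, g, h, hg, hh, hne, hiso⟩ :=
      ih fun c hc => h𝒜 c (Finset.mem_insert_of_mem hc)
    have ha : 1 < a := h𝒜 a (Finset.mem_insert_self a s)
    have : NeZero a := ⟨by omega⟩
    have hcyc : Function.Bijective fun x : ZMod a => x + 1 := (Equiv.addRight 1).bijective
    refine ⟨(ZMod a × β) ⊕ (ZMod a × γ), (ZMod a × γ) ⊕ (ZMod a × β), inferInstance,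
      inferInstance, Sum.map (Prod.map (· + 1) g) (Prod.map id h),
      Sum.map (Prod.map (· + 1) h) (Prod.map id g),
      Sum.map_bijective.2 ⟨hcyc.prodMap hg, Function.bijective_id.prodMap hh⟩,
      Sum.map_bijective.2 ⟨hcyc.prodMap hh, Function.bijective_id.prodMap hg⟩, ?_, ?_⟩
    · rw [card_fixedPoints_sumMap_cycle ha, card_fixedPoints_sumMap_cycle ha]
      exact fun heq => hne (Nat.eq_of_mul_eq_mul_left (by omega) heq).symm
    · intro c hc
      refine (FDSIso.prodMap_sumMap _ _ _).trans (.trans ?_ (FDSIso.prodMap_sumMap _ _ _).symm)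
      obtain rfl | hc := Finset.mem_insert.1 hc
      · exact ((FDSIso.cycle_prodMap_cycle c g).sumMap (FDSIso.cycle_prodMap_cycle c h).symm).trans
          (FDSIso.sumMap_comm _ _)
      · exact ((hiso c hc).prodMap_prodMap_of_prodMap _).sumMap
          ((hiso c hc).symm.prodMap_prodMap_of_prodMap _)

/-- For any finite set `𝒜` of integers greater than `1`, there are two non-isomorphic
permutation FDSs `g` and `h` such that `C_a × g ≅ C_a × h` for every `a ∈ 𝒜`. -/
theorem exists_noncancellable_pair (𝒜 : Finset ℕ) (h𝒜 : ∀ a ∈ 𝒜, 1 < a) :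
    ∃ (β γ : Type) (_ : Fintype β) (_ : Fintype γ) (g : β → β) (h : γ → γ),
      Function.Bijective g ∧ Function.Bijective h ∧ ¬ FDSIso g h ∧
      ∀ a ∈ 𝒜,
        FDSIso (Prod.map (fun x : ZMod a => x + 1) g)
               (Prod.map (fun x : ZMod a => x + 1) h) := by
  obtain ⟨β, γ, _, _, g, h, hg, hh, hne, hiso⟩ := exists_pair_card_fixedPoints_ne 𝒜 h𝒜
  exact ⟨β, γ, inferInstance, inferInstance, g, h, hg, hh,
    fun H => hne H.card_fixedPoints_eq, hiso⟩
end

section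
/- Let k ≥ 1 and let f : α → α and g : β → β be FDSs on finite sets such that the k-th power f^⊗k is isomorphic to the k-th power g^⊗k. Then the restriction of f to its set of periodic states is isomorphic to the restriction of g to its set of periodic states (both restrictions are well defined since the set of periodic states is invariant under the map). -/
/-- A state `x` is periodic for `f` if `f^[n] x = x` for some `n ≥ 1`. -/
def IsPerState {α : Type} (f : α → α) (x : α) : Prop :=
  ∃ n, 1 ≤ n ∧ f^[n] x = x

theorem isPerState_apply {α : Type} {f : α → α} {x : α} (h : IsPerState f x) :
    IsPerState f (f x) := by
  obtain ⟨n, hn, hx⟩ := h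
  refine ⟨n, hn, ?_⟩
  rw [← Function.iterate_succ_apply, Function.iterate_succ_apply', hx]

/-- The restriction of an FDS to its set of periodic states. -/
def perRestrict {α : Type} (f : α → α) :
    {x : α // IsPerState f x} → {x : α // IsPerState f x} :=
  fun x => ⟨f x.1, isPerState_apply x.2⟩

open Function in
theorem card_iterate_eq_sum_card_minimalPeriod {α : Type} [Fintype α] [DecidableEq α]
    (f : α → α) {n : ℕ} (hn : n ≠ 0) :
    ({x | f^[n] x = x} : Finset α).card =
      ∑ d ∈ n.divisors, ({x | minimalPeriod f x = d} : Finset α).card := by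
  rw [Finset.card_eq_sum_card_fiberwise (f := minimalPeriod f) (t := n.divisors)]
  · refine Finset.sum_congr rfl fun d hd => ?_
    congr 1
    ext x
    simp only [Finset.mem_filter, Finset.mem_univ, true_and, and_iff_right_iff_imp]
    rintro rfl
    exact isPeriodicPt_iff_minimalPeriod_dvd.2 (Nat.dvd_of_mem_divisors hd)
  · intro x hx
    have hx : IsPeriodicPt f n x := (Finset.mem_filter.1 hx).2
    simpa [hn] using hx.minimalPeriod_dvd

open Function in
theorem card_minimalPeriod_eq {α β : Type} [Fintype α] [Fintype β] [DecidableEq α]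
    [DecidableEq β] {f : α → α} {g : β → β}
    (h : ∀ n ≠ 0, ({x | f^[n] x = x} : Finset α).card = ({x | g^[n] x = x} : Finset β).card)
    {n : ℕ} (hn : n ≠ 0) :
    ({x | minimalPeriod f x = n} : Finset α).card =
      ({x | minimalPeriod g x = n} : Finset β).card := by
  induction n using Nat.strong_induction_on with
  | _ n ih =>
    have key := h n hn
    rw [card_iterate_eq_sum_card_minimalPeriod f hn, card_iterate_eq_sum_card_minimalPeriod g hn,
      ← Nat.cons_self_properDivisors hn, Finset.sum_cons, Finset.sum_cons,
      Finset.sum_congr rfl fun d hd => ih d (Nat.mem_properDivisors.1 hd).2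
        (Nat.pos_of_mem_properDivisors hd).ne'] at key
    exact Nat.add_right_cancel key

namespace Equiv.Perm

variable {α β : Type} [Fintype α] [DecidableEq α] [Fintype β] [DecidableEq β]

theorem minimalPeriod_eq_card_support_cycleOf (σ : Perm α) {x : α} (hx : σ x ≠ x) :
    Function.minimalPeriod σ x = (σ.cycleOf x).support.card := by
  refine Nat.dvd_right_iff_eq.1 fun n => ?_
  have hc := isCycle_cycleOf σ hx
  rw [← Function.isPeriodicPt_iff_minimalPeriod_dvd, ← hc.orderOf, orderOf_dvd_iff_pow_eq_one,
    hc.pow_eq_one_iff' (x := x) (by simpa using hx), cycleOf_pow_apply_self,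
    Function.IsPeriodicPt, Function.IsFixedPt, iterate_eq_pow]

theorem card_minimalPeriod_eq_count_cycleType_mul (σ : Perm α) {n : ℕ} (hn : 2 ≤ n) :
    ({x | Function.minimalPeriod σ x = n} : Finset α).card = σ.cycleType.count n * n := by
  have ne_of {x : α} (hx : Function.minimalPeriod σ x = n) : σ x ≠ x := fun h => by
    have := Function.minimalPeriod_eq_one_iff_isFixedPt.2 h
    lia
  have hcount : σ.cycleType.count n =
      ({c ∈ σ.cycleFactorsFinset | c.support.card = n} : Finset (Perm α)).card := by
    rw [cycleType_def, Multiset.count_map, Finset.card_def, Finset.filter_val]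
    simp [eq_comm]
  rw [hcount, Finset.card_eq_sum_card_fiberwise (f := σ.cycleOf)
    (t := {c ∈ σ.cycleFactorsFinset | c.support.card = n})]
  · refine Finset.sum_const_nat fun c hc => ?_
    obtain ⟨hcσ, rfl⟩ := Finset.mem_filter.1 hc
    congr 1
    ext x
    simp only [Finset.mem_filter, Finset.mem_univ, true_and]
    constructor
    · rintro ⟨hx, rfl⟩
      exact mem_support_cycleOf_iff.2 ⟨SameCycle.refl σ x, mem_support.2 (ne_of hx)⟩
    · intro hx
      have hxσ := mem_support.1 (mem_cycleFactorsFinset_support_le hcσ hx)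
      have hcx := cycle_is_cycleOf hx hcσ
      exact ⟨by rw [minimalPeriod_eq_card_support_cycleOf σ hxσ, ← hcx], hcx.symm⟩
  · intro x hx
    have hx : Function.minimalPeriod σ x = n := (Finset.mem_filter.1 hx).2
    simp only [Finset.coe_filter, Set.mem_ofPred_eq, cycleOf_mem_cycleFactorsFinset_iff]
    exact ⟨mem_support.2 (ne_of hx),
      by rw [← minimalPeriod_eq_card_support_cycleOf σ (ne_of hx), hx]⟩

theorem exists_equiv_of_card_iterate_eq (σ : Perm α) (τ : Perm β)
    (h : ∀ n ≠ 0, ({x | σ^[n] x = x} : Finset α).card = ({x | τ^[n] x = x} : Finset β).card) :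
    ∃ e : α ≃ β, ∀ x, e (σ x) = τ (e x) := by
  have hcard : Fintype.card α = Fintype.card β := by
    have := h (orderOf σ * orderOf τ) (mul_ne_zero (orderOf_pos σ).ne' (orderOf_pos τ).ne')
    have hσ : σ ^ (orderOf σ * orderOf τ) = 1 := by rw [pow_mul, pow_orderOf_eq_one, one_pow]
    have hτ : τ ^ (orderOf σ * orderOf τ) = 1 := by rw [pow_mul', pow_orderOf_eq_one, one_pow]
    simpa [iterate_eq_pow, hσ, hτ] using this
  let e := Fintype.equivOfCardEq hcard
  let τ' : Perm α := e.symm.permCongr τ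
  have iter (n : ℕ) (x : α) : τ'^[n] x = e.symm (τ^[n] (e x)) := by
    have := Function.Semiconj.iterate_right (f := e.symm) (ga := τ) (gb := τ')
      (fun y => by simp [τ', permCongr_apply]) n (e x)
    simpa using this.symm
  have h' : ∀ n ≠ 0,
      ({x | σ^[n] x = x} : Finset α).card = ({x | τ'^[n] x = x} : Finset α).card := by
    intro n hn
    rw [h n hn]
    refine Finset.card_equiv e.symm fun y => ?_
    simp [iter]
  have hconj : IsConj σ τ' := by
    rw [isConj_iff_cycleType_eq]
    ext n
    rcases lt_or_ge n 2 with hn | hn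
    · rw [Multiset.count_eq_zero_of_notMem, Multiset.count_eq_zero_of_notMem] <;>
        exact fun hm => (two_le_of_mem_cycleType hm).not_gt hn
    · have := card_minimalPeriod_eq h' (n := n) (by lia)
      rw [card_minimalPeriod_eq_count_cycleType_mul σ hn,
        card_minimalPeriod_eq_count_cycleType_mul τ' hn] at this
      exact Nat.eq_of_mul_eq_mul_right (by lia) this
  obtain ⟨c, hc⟩ := isConj_iff.1 hconj
  refine ⟨c.trans e, fun x => ?_⟩
  have := DFunLike.congr_fun hc (c x)
  simp only [mul_apply, τ', permCongr_apply, symm_symm, ← Equiv.Perm.mul_apply c⁻¹ c,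
    inv_mul_cancel, one_apply] at this
  simpa using congrArg e this

end Equiv.Perm

theorem perRestrict_iterate {α : Type} (f : α → α) (n : ℕ) (x : {x : α // IsPerState f x}) :
    ((perRestrict f)^[n] x : α) = f^[n] x :=
  (Function.Semiconj.iterate_right (f := Subtype.val) (ga := perRestrict f) (gb := f)
    (fun _ => rfl) n) x

theorem perRestrict_bijective {α : Type} [Finite α] (f : α → α) :
    Function.Bijective (perRestrict f) := by
  refine Finite.surjective_iff_bijective.1 fun x => ?_
  obtain ⟨n, hn, hx⟩ := x.2
  refine ⟨(perRestrict f)^[n - 1] x, Subtype.ext ?_⟩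
  rw [← Function.iterate_succ_apply' (perRestrict f), perRestrict_iterate, Nat.succ_eq_add_one,
    Nat.sub_add_cancel hn, hx]

theorem card_iterate_perRestrict {α : Type} [Fintype α] [DecidableEq α] (f : α → α)
    [Fintype {x : α // IsPerState f x}] {n : ℕ} (hn : n ≠ 0) :
    ({x | (perRestrict f)^[n] x = x} : Finset {x : α // IsPerState f x}).card =
      ({x | f^[n] x = x} : Finset α).card := by
  refine Finset.card_bij (fun x _ => x) (fun x hx => ?_) (fun _ _ _ _ => Subtype.ext)
    fun x hx => ?_
  · simpa [Subtype.ext_iff, perRestrict_iterate] using hx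
  · have hx : f^[n] x = x := by simpa using hx
    exact ⟨⟨x, n, Nat.one_le_iff_ne_zero.2 hn, hx⟩, by
      simpa [Subtype.ext_iff, perRestrict_iterate] using hx, rfl⟩

theorem card_iterate_comp {α : Type} [Fintype α] [DecidableEq α] (k : ℕ) (f : α → α) (n : ℕ) :
    ({v | (fun v : Fin k → α => f ∘ v)^[n] v = v} : Finset (Fin k → α)).card =
      ({x | f^[n] x = x} : Finset α).card ^ k := by
  have iter (v : Fin k → α) : (fun v : Fin k → α => f ∘ v)^[n] v = f^[n] ∘ v := by
    induction n with
    | zero => rfl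
    | succ n ih => rw [Function.iterate_succ_apply', ih, Function.iterate_succ', Function.comp_assoc]
  rw [← Fintype.card_piFinset_const]
  congr 1
  ext v
  simp [iter, funext_iff]

theorem FDSIso.card_iterate_eq {α β : Type} [Fintype α] [Fintype β] [DecidableEq α]
    [DecidableEq β] {f : α → α} {g : β → β} (h : FDSIso f g) (n : ℕ) :
    ({x | f^[n] x = x} : Finset α).card = ({x | g^[n] x = x} : Finset β).card := by
  obtain ⟨e, he⟩ := h
  refine Finset.card_equiv e fun x => ?_
  have := Function.Semiconj.iterate_right he n x
  simp [← this]

/-- If the `k`-th powers of two FDSs are isomorphic, then their restrictions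
to their periodic parts are isomorphic. -/
theorem fds_kth_power_iso_periodic_parts (α β : Type) [Fintype α] [Fintype β]
    (k : ℕ) (hk : 1 ≤ k) (f : α → α) (g : β → β)
    (h : FDSIso (fun v : Fin k → α => f ∘ v) (fun v : Fin k → β => g ∘ v)) :
    FDSIso (perRestrict f) (perRestrict g) := by
  classical
  refine Equiv.Perm.exists_equiv_of_card_iterate_eq
    (Equiv.ofBijective _ (perRestrict_bijective f))
    (Equiv.ofBijective _ (perRestrict_bijective g)) fun n hn => ?_
  have hpow := h.card_iterate_eq n
  rw [card_iterate_comp, card_iterate_comp] at hpow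
  have hfg := Nat.pow_left_injective (Nat.one_le_iff_ne_zero.1 hk) hpow
  rw [← card_iterate_perRestrict f hn, ← card_iterate_perRestrict g hn] at hfg
  exact hfg
end

section
/- Let n ∈ ℕ and let l : Fin n → ℕ with l i ≥ 1 for all i. Let L = lcm of the l i and δ = (∏ i, l i) / L. Then the product of cycles ∏_{i} C_{l i} is isomorphic to the disjoint sum of δ copies of C_L; that is, there is a bijection e : (Π i : Fin n, ZMod (l i)) → Fin δ × ZMod L such that e(λ i, x i + 1) = (j, z + 1) whenever e(x) = (j, z). -/
/-- An injective homomorphism `φ : A →+ G` identifies `G` with copies of `A`, one for each coset of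
its range, in such a way that translation by `a` on `A` becomes translation by `φ a` on `G`. -/
theorem AddMonoidHom.exists_equiv_quotient_range_prod {A G : Type*} [AddGroup A] [AddGroup G]
    (φ : A →+ G) (hφ : Function.Injective φ) :
    ∃ e : G ≃ (G ⧸ φ.range) × A, ∀ x a, e (x + φ a) = ((e x).1, (e x).2 + a) := by
  let f : (G ⧸ φ.range) × A → G := fun p => p.1.out + φ p.2
  have mk_f (p : (G ⧸ φ.range) × A) : (f p : G ⧸ φ.range) = p.1 := by
    rw [QuotientAddGroup.mk_add_of_mem _ (φ.mem_range.mpr ⟨p.2, rfl⟩), QuotientAddGroup.out_eq']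
  have hf : Function.Bijective f := by
    refine ⟨fun p p' h => ?_, fun x => ?_⟩
    · have h₁ : p.1 = p'.1 := by rw [← mk_f p, ← mk_f p', h]
      refine Prod.ext h₁ (hφ ?_)
      simpa [f, h₁] using h
    · obtain ⟨a, ha⟩ := QuotientAddGroup.eq.mp (QuotientAddGroup.out_eq' (x : G ⧸ φ.range))
      exact ⟨(x, a), by simp [f, ha]⟩
  refine ⟨(Equiv.ofBijective f hf).symm, fun x a => ?_⟩
  obtain ⟨p, rfl⟩ := hf.2 x
  rw [Equiv.symm_apply_eq, Equiv.ofBijective_symm_apply_apply]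
  simp [f, add_assoc]

/-- The diagonal map from `ZMod` of the lcm of a family to the product of the `ZMod (l i)`. -/
def ZMod.lcmToPi {ι : Type*} [Fintype ι] (l : ι → ℕ) :
    ZMod (Finset.univ.lcm l) →+* ((i : ι) → ZMod (l i)) :=
  RingHom.pi fun i => ZMod.castHom (Finset.dvd_lcm (Finset.mem_univ i)) (ZMod (l i))

theorem ZMod.lcmToPi_injective {ι : Type*} [Fintype ι] (l : ι → ℕ) :
    Function.Injective (ZMod.lcmToPi l) := by
  refine (injective_iff_map_eq_zero _).mpr fun z hz => ?_
  obtain ⟨k, rfl⟩ := ZMod.intCast_surjective z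
  rw [ZMod.intCast_zmod_eq_zero_iff_dvd, Int.natCast_dvd]
  refine Finset.lcm_dvd fun i _ => ?_
  rw [← Int.natCast_dvd, ← ZMod.intCast_zmod_eq_zero_iff_dvd]
  simpa using congrFun hz i

/-- A product of cycles `∏ i, C_{l i}` is isomorphic to `(∏ i, l i) / L` disjoint
copies of `C_L`, where `L` is the lcm of the `l i`. -/
theorem prod_cycles (n : ℕ) (l : Fin n → ℕ) (hl : ∀ i, 1 ≤ l i) :
    ∃ e : ((i : Fin n) → ZMod (l i)) ≃
        Fin ((∏ i, l i) / Finset.univ.lcm l) × ZMod (Finset.univ.lcm l),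
      ∀ x : (i : Fin n) → ZMod (l i),
        e (fun i => x i + 1) = ((e x).1, (e x).2 + 1) := by
  have (i : Fin n) : NeZero (l i) := ⟨Nat.one_le_iff_ne_zero.mp (hl i)⟩
  have hL : 0 < Finset.univ.lcm l := by
    simp [Nat.pos_iff_ne_zero, Finset.lcm_eq_zero_iff, NeZero.ne]
  obtain ⟨e, he⟩ := (ZMod.lcmToPi l).toAddMonoidHom.exists_equiv_quotient_range_prod
    (ZMod.lcmToPi_injective l)
  have hcard : Nat.card (((i : Fin n) → ZMod (l i)) ⧸ (ZMod.lcmToPi l).toAddMonoidHom.range) =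
      (∏ i, l i) / Finset.univ.lcm l := by
    have h := Nat.card_congr e
    rw [Nat.card_prod, Nat.card_pi] at h
    simp only [Nat.card_zmod] at h
    rw [h, Nat.mul_div_cancel _ hL]
  refine ⟨e.trans ((Finite.equivFinOfCardEq hcard).prodCongr (Equiv.refl _)), fun x => ?_⟩
  have hx : (fun i => x i + 1) = x + (ZMod.lcmToPi l).toAddMonoidHom 1 := by
    ext i
    simp
  rw [hx, Equiv.trans_apply, he]
  rfl
end

section
/- Let f : α → α and g : β → β be FDSs on finite nonempty sets. Then for every state (a, b) of the product f × g, the depth of (a, b) in f × g equals max(depth of a in f, depth of b in g). Consequently, for every k ∈ ℕ, the restriction of f × g to its set of states of depth at most k is isomorphic to the product of the restriction of f to its states of depth at most k with the restriction of g to its states of depth at most k. -/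
/-- The depth of a state: the least `n` such that `f^[n] x` is periodic. -/
noncomputable def fdsDepth {α : Type} (f : α → α) (x : α) : ℕ :=
  sInf {n | IsPerState f (f^[n] x)}

theorem exists_iterate_perState {α : Type} [Finite α] (f : α → α) (x : α) :
    ∃ n, IsPerState f (f^[n] x) := by
  obtain ⟨m, n, hmn, hkey⟩ := Finite.exists_ne_map_eq_of_infinite (fun k : ℕ => f^[k] x)
  rcases Nat.lt_or_ge m n with h' | h'
  · refine ⟨m, n - m, by omega, ?_⟩
    rw [← Function.iterate_add_apply]
    have : n - m + m = n := by omega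
    rw [this]; exact hkey.symm
  · have hnm : n < m := by omega
    refine ⟨n, m - n, by omega, ?_⟩
    rw [← Function.iterate_add_apply]
    have : m - n + n = m := by omega
    rw [this]; exact hkey

theorem fdsDepth_apply_le {α : Type} [Finite α] (f : α → α) (x : α) :
    fdsDepth f (f x) ≤ fdsDepth f x := by
  have hmem : fdsDepth f x ∈ {n | IsPerState f (f^[n] x)} :=
    Nat.sInf_mem (exists_iterate_perState f x)
  apply Nat.sInf_le
  show IsPerState f (f^[fdsDepth f x] (f x))
  rw [← Function.iterate_succ_apply, Function.iterate_succ_apply']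
  exact isPerState_apply hmem

/-- The restriction of `f` to its set of states of depth at most `k`. -/
noncomputable def truncRestrict {α : Type} [Finite α] (f : α → α) (k : ℕ) :
    {x : α // fdsDepth f x ≤ k} → {x : α // fdsDepth f x ≤ k} :=
  fun x => ⟨f x.1, le_trans (fdsDepth_apply_le f x.1) x.2⟩

theorem isPerState_prodMap_iff {α β : Type} {f : α → α} {g : β → β} {x : α × β} :
    IsPerState (Prod.map f g) x ↔ IsPerState f x.1 ∧ IsPerState g x.2 := by
  constructor
  · rintro ⟨n, hn, h⟩
    obtain ⟨h₁, h₂⟩ := (Function.isPeriodicPt_prodMap x).mp h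
    exact ⟨⟨n, hn, h₁⟩, ⟨n, hn, h₂⟩⟩
  · rintro ⟨⟨m, hm, h₁⟩, ⟨n, hn, h₂⟩⟩
    exact ⟨m * n, Nat.mul_pos hm hn, (Function.isPeriodicPt_prodMap x).mpr
      ⟨Function.IsPeriodicPt.mul_const h₁ n, Function.IsPeriodicPt.const_mul h₂ m⟩⟩

theorem isPerState_iterate {α : Type} {f : α → α} {x : α} (h : IsPerState f x) (k : ℕ) :
    IsPerState f (f^[k] x) := by
  obtain ⟨n, hn, hx⟩ := h
  exact ⟨n, hn, Function.IsPeriodicPt.apply_iterate hx k⟩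

theorem fdsDepth_le_iff {α : Type} [Finite α] {f : α → α} {x : α} {k : ℕ} :
    fdsDepth f x ≤ k ↔ IsPerState f (f^[k] x) := by
  refine ⟨fun h => ?_, fun h => Nat.sInf_le h⟩
  have hmem : IsPerState f (f^[fdsDepth f x] x) := Nat.sInf_mem (exists_iterate_perState f x)
  rw [← Nat.sub_add_cancel h, Function.iterate_add_apply]
  exact isPerState_iterate hmem _

theorem fdsDepth_prodMap_le_iff {α β : Type} [Finite α] [Finite β] {f : α → α} {g : β → β}
    {x : α × β} {k : ℕ} :
    fdsDepth (Prod.map f g) x ≤ k ↔ fdsDepth f x.1 ≤ k ∧ fdsDepth g x.2 ≤ k := by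
  simp only [fdsDepth_le_iff, Prod.map_iterate, isPerState_prodMap_iff, Prod.map_fst, Prod.map_snd]

/-- The depth of a state of a product is the maximum of the depths of its components,
and the truncature of a product is the product of the truncatures. -/
theorem fds_depth_prod_and_trunc_prod (α β : Type) [Fintype α] [Fintype β]
    [Nonempty α] [Nonempty β] (f : α → α) (g : β → β) :
    (∀ (a : α) (b : β),
        fdsDepth (Prod.map f g) (a, b) = max (fdsDepth f a) (fdsDepth g b)) ∧
    ∀ k : ℕ,
      FDSIso (truncRestrict (Prod.map f g) k)
             (Prod.map (truncRestrict f k) (truncRestrict g k)) := by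
  refine ⟨fun a b => eq_of_forall_ge_iff fun k => ?_, fun k => ?_⟩
  · rw [fdsDepth_prodMap_le_iff, max_le_iff]
  · exact ⟨(Equiv.subtypeEquivRight fun _ => fdsDepth_prodMap_le_iff).trans
      (Equiv.subtypeProdEquivProd (p := (fdsDepth f · ≤ k)) (q := (fdsDepth g · ≤ k))),
      fun _ => rfl⟩
end

section
/- A linear dendron f : α → α on a finite set α is reducible (i.e., isomorphic to a product g × h of two FDSs on finite sets each of cardinality at least 2) if and only if f is a star and the cardinality of α is composite (|α| = a·b for some integers a, b ≥ 2). -/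
/-- A linear dendron: a dendron (an FDS with a fixpoint `r` reached by every state)
in which every state other than the fixpoint has at most one preimage. -/
def IsLinearDendron {α : Type} (f : α → α) : Prop :=
  ∃ r, f r = r ∧ (∀ x, ∃ n, f^[n] x = r) ∧
    ∀ x, x ≠ r → ∀ y z, f y = x → f z = x → y = z

/-- A star: an FDS sending every state directly to a fixpoint. -/
def IsStar {α : Type} (f : α → α) : Prop :=
  ∃ r, ∀ x, f x = r

theorem IsLinearDendron.of_iso {α β : Type} {f : α → α} {g : β → β}
    (hf : IsLinearDendron f) (h : FDSIso f g) : IsLinearDendron g := by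
  obtain ⟨r, hr, hreach, hinj⟩ := hf
  obtain ⟨e, he⟩ := h
  have hs : ∀ y, e.symm (g y) = f (e.symm y) := fun y ↦ by
    rw [Equiv.symm_apply_eq, he, e.apply_symm_apply]
  refine ⟨e r, by rw [← he, hr], fun y ↦ ?_, fun x hx y z hy hz ↦ ?_⟩
  · obtain ⟨n, hn⟩ := hreach (e.symm y)
    have hsemi : Function.Semiconj e f g := he
    refine ⟨n, ?_⟩
    rw [← hn, (hsemi.iterate_right n).eq, e.apply_symm_apply]
  · refine e.symm.injective (hinj (e.symm x) (fun h ↦ hx ?_) _ _ ?_ ?_)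
    · rw [← h, e.apply_symm_apply]
    · rw [← hs, hy]
    · rw [← hs, hz]

theorem fdsIso_prodMap_swap {β γ : Type} (g : β → β) (h : γ → γ) :
    FDSIso (Prod.map g h) (Prod.map h g) :=
  ⟨Equiv.prodComm β γ, fun _ ↦ rfl⟩

theorem exists_ne_map_eq_of_iterate_eq {γ : Type} [Nontrivial γ] {h : γ → γ} {s : γ}
    (hreach : ∀ x, ∃ n, h^[n] x = s) : ∃ c, c ≠ s ∧ h c = s := by
  by_contra! hne
  obtain ⟨x, hx⟩ := exists_ne s
  have key : ∀ n, h^[n] x ≠ s := by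
    intro n
    induction n with
    | zero => exact hx
    | succ n ih =>
      rw [Function.iterate_succ_apply']
      exact hne _ ih
  obtain ⟨n, hn⟩ := hreach x
  exact key n hn

/-- A state `b = g a` other than the root would give `(b, s)` two preimages `(a, s)` and `(a, c)`,
where `c ≠ s` is a preimage of the root `s` of `h`. -/
theorem IsLinearDendron.isStar_left {β γ : Type} [Nontrivial γ] {g : β → β} {h : γ → γ}
    (hf : IsLinearDendron (Prod.map g h)) : IsStar g := by
  obtain ⟨⟨r, s⟩, hr, hreach, hinj⟩ := hf
  have hs : h s = s := congrArg Prod.snd hr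
  have hreach_snd : ∀ x, ∃ n, h^[n] x = s := fun x ↦ by
    obtain ⟨n, hn⟩ := hreach (r, x)
    rw [Prod.map_iterate] at hn
    exact ⟨n, congrArg Prod.snd hn⟩
  obtain ⟨c, hc, hcs⟩ := exists_ne_map_eq_of_iterate_eq hreach_snd
  refine ⟨r, fun a ↦ ?_⟩
  by_contra ha
  have heq := hinj (g a, s) (fun h ↦ ha (congrArg Prod.fst h)) (a, c) (a, s)
    (Prod.ext rfl hcs) (Prod.ext rfl hs)
  exact hc (congrArg Prod.snd heq)

/-- A linear dendron is reducible iff it is a star with a composite number of states. -/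
theorem linearDendron_reducible_iff (α : Type) [Fintype α] (f : α → α)
    (hf : IsLinearDendron f) :
    (∃ (β γ : Type) (_ : Fintype β) (_ : Fintype γ) (g : β → β) (h : γ → γ),
        2 ≤ Nat.card β ∧ 2 ≤ Nat.card γ ∧ FDSIso f (Prod.map g h))
      ↔ (IsStar f ∧ ∃ a b : ℕ, 2 ≤ a ∧ 2 ≤ b ∧ Fintype.card α = a * b) := by
  constructor
  · rintro ⟨β, γ, _, _, g, h, hβ, hγ, hiso⟩
    rw [Nat.card_eq_fintype_card] at hβ hγ
    have : Nontrivial β := Fintype.one_lt_card_iff_nontrivial.mp hβ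
    have : Nontrivial γ := Fintype.one_lt_card_iff_nontrivial.mp hγ
    have hprod := hf.of_iso hiso
    obtain ⟨r, hr⟩ := hprod.isStar_left
    obtain ⟨s, hs⟩ := (hprod.of_iso (fdsIso_prodMap_swap g h)).isStar_left
    obtain ⟨e, he⟩ := hiso
    refine ⟨⟨e.symm (r, s), fun x ↦ ?_⟩, _, _, hβ, hγ, ?_⟩
    · rw [Equiv.eq_symm_apply, he]
      exact Prod.ext (hr _) (hs _)
    · rw [Fintype.card_congr e, Fintype.card_prod]
  · rintro ⟨⟨r, hr⟩, a, b, ha, hb, hab⟩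
    have e : α ≃ Fin a × Fin b := Fintype.equivOfCardEq (by simpa using hab)
    refine ⟨Fin a, Fin b, inferInstance, inferInstance, fun _ ↦ (e r).1, fun _ ↦ (e r).2,
      by simpa using ha, by simpa using hb, e, fun x ↦ ?_⟩
    rw [hr]
    rfl
end
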